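/- arXiv:2306.03633 — 2 statements merged into one kernel-verified Lean document; each statement's English description precedes it below -/
import Mathlib

section
/- (Representation Theorem, necessity) Let X be a Banach space with an approximation scheme (A_n), let 0 < ρ < ∞ and 0 < μ ≤ ∞. If f ∈ X satisfies (n^{ρ − 1/μ} α_n(f, X))_{n≥1} ∈ ℓ_μ, then there exist elements g_n ∈ A_{2^n} (n = 0, 1, 2, …) such that f = Σ_{n=0}^∞ g_n with convergence in X and (2^{nρ} ‖g_n‖_X)_{n≥0} ∈ ℓ_μ. -/
open scoped ENNReal

/-- An approximation scheme on a Banach space `X`: a family of subsets `A n ⊆ X` with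
`A 0 = {0}`, `A n ⊆ A (n+1)`, `λ • A n ⊆ A n`, `A m + A n ⊆ A (m+n)`, and `⋃ n, A n`
dense in `X`. -/
structure ApproximationScheme (X : Type*) [NormedAddCommGroup X] [NormedSpace ℂ X] where
  A : ℕ → Set X
  zero_eq : A 0 = {0}
  mono : ∀ n : ℕ, A n ⊆ A (n + 1)
  smul_mem : ∀ (c : ℂ) (n : ℕ), ∀ a ∈ A n, c • a ∈ A n
  add_mem : ∀ (m n : ℕ), ∀ a ∈ A m, ∀ b ∈ A n, a + b ∈ A (m + n)
  dense : Dense (⋃ n : ℕ, A n)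

variable {X : Type*} [NormedAddCommGroup X] [NormedSpace ℂ X]

/-- `approxError S f n` is the `(n+1)`-st approximation number `α_{n+1}(f, X)` of `f`
with respect to the scheme `S`: the error of best approximation of `f` by elements
of `A n`. -/
noncomputable def approxError (S : ApproximationScheme X) (f : X) (n : ℕ) : ℝ :=
  sInf {c : ℝ | ∃ a ∈ S.A n, c = ‖f - a‖}

/-- Membership of a real sequence in `ℓ_μ` for `0 < μ ≤ ∞`: summability of `|c n| ^ μ`
for finite `μ`, boundedness for `μ = ∞`. -/
def MemEllMu (μ : ℝ≥0∞) (c : ℕ → ℝ) : Prop :=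
  if μ = ∞ then ∃ M : ℝ, ∀ n : ℕ, |c n| ≤ M
  else Summable fun n : ℕ => |c n| ^ μ.toReal

theorem rn_mono (S : ApproximationScheme X) : Monotone S.A :=
  monotone_nat_of_le_succ S.mono

theorem rn_zero_mem (S : ApproximationScheme X) (n : ℕ) : (0 : X) ∈ S.A n :=
  rn_mono S (Nat.zero_le n) (by simp [S.zero_eq])

theorem rn_bdd (S : ApproximationScheme X) (f : X) (n : ℕ) :
    BddBelow {c : ℝ | ∃ a ∈ S.A n, c = ‖f - a‖} :=
  ⟨0, by rintro c ⟨a, _, rfl⟩; exact norm_nonneg _⟩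

theorem rn_nonempty (S : ApproximationScheme X) (f : X) (n : ℕ) :
    {c : ℝ | ∃ a ∈ S.A n, c = ‖f - a‖}.Nonempty :=
  ⟨_, 0, rn_zero_mem S n, rfl⟩

theorem rn_nonneg (S : ApproximationScheme X) (f : X) (n : ℕ) : 0 ≤ approxError S f n :=
  Real.sInf_nonneg (by rintro c ⟨a, _, rfl⟩; exact norm_nonneg _)

theorem rn_anti (S : ApproximationScheme X) (f : X) : Antitone (approxError S f) := by
  intro m n hmn
  apply csInf_le_csInf (rn_bdd S f n) (rn_nonempty S f m)
  rintro c ⟨a, ha, rfl⟩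
  exact ⟨a, rn_mono S hmn ha, rfl⟩

theorem rn_exists (S : ApproximationScheme X) (f : X) (n : ℕ) (δ : ℝ) (hδ : 0 < δ) :
    ∃ a ∈ S.A n, ‖f - a‖ ≤ approxError S f n + δ := by
  obtain ⟨c, ⟨a, ha, rfl⟩, hc⟩ := Real.lt_sInf_add_pos (rn_nonempty S f n) hδ
  exact ⟨a, ha, hc.le⟩

theorem rn_tendsto (S : ApproximationScheme X) (f : X) :
    Filter.Tendsto (approxError S f) Filter.atTop (nhds 0) := by
  rw [Metric.tendsto_atTop]
  intro ε hε
  obtain ⟨a, ha, hd⟩ := Metric.dense_iff.1 S.dense f ε hε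
  obtain ⟨N, hN⟩ := Set.mem_iUnion.1 hd
  refine ⟨N, fun n hn => ?_⟩
  rw [Real.dist_eq, sub_zero, abs_of_nonneg (rn_nonneg S f n)]
  refine (rn_anti S f hn).trans_lt ?_
  refine (csInf_le (rn_bdd S f N) ⟨a, hN, rfl⟩).trans_lt ?_
  rw [← dist_eq_norm, dist_comm]
  exact ha

theorem rn_cond (u : ℕ → ℝ) (hu : Antitone u) (h0 : ∀ n, 0 ≤ u n) (s : ℝ)
    (h : Summable fun n : ℕ => ((n : ℝ) + 1) ^ (s - 1) * u n) :
    Summable fun n : ℕ => (2 : ℝ) ^ ((n : ℝ) * s) * u (2 ^ n / 4) := by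
  rw [← summable_nat_add_iff 3]
  obtain ⟨c, hc, hc1, hc2⟩ : ∃ c : ℝ, 0 < c ∧ c ≤ 1 ∧ c ≤ 2 ^ (s - 1) :=
    ⟨min 1 (2 ^ (s - 1)), by positivity, min_le_left _ _, min_le_right _ _⟩
  have hv : ∀ n : ℕ, 0 ≤ ((n : ℝ) + 1) ^ (s - 1) * u n := fun n =>
    mul_nonneg (by positivity) (h0 n)
  have key : ∀ N : ℕ, ∑ n ∈ Finset.range N, c * ((2 : ℝ) ^ ((n : ℝ) * s) * u (2 ^ (n + 1)))
      ≤ ∑ k ∈ Finset.range (2 ^ N), ((k : ℝ) + 1) ^ (s - 1) * u k := by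
    intro N
    induction N with
    | zero => simpa using h0 0
    | succ N ih =>
      rw [Finset.sum_range_succ, ← Finset.sum_range_add_sum_Ico _
        (Nat.pow_le_pow_right (by norm_num : 0 < 2) (Nat.le_succ N))]
      refine add_le_add ih ?_
      have hb : ∀ k : ℕ, k ∈ Finset.Ico (2 ^ N) (2 ^ (N + 1)) →
          c * (2 : ℝ) ^ ((N : ℝ) * (s - 1)) * u (2 ^ (N + 1)) ≤ ((k : ℝ) + 1) ^ (s - 1) * u k := by
        intro k hk
        rw [Finset.mem_Ico] at hk
        have h1 : (2 : ℝ) ^ N ≤ (k : ℝ) + 1 := by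
          have : (2 : ℝ) ^ N ≤ k := by exact_mod_cast hk.1
          linarith
        have h2 : (k : ℝ) + 1 ≤ 2 ^ N * 2 := by
          rw [← pow_succ]; exact_mod_cast hk.2
        refine mul_le_mul ?_ (hu hk.2.le) (h0 _) (by positivity)
        rw [Real.rpow_mul (by norm_num), Real.rpow_natCast]
        have hp : (0 : ℝ) < (2 ^ N) ^ (s - 1) := by positivity
        rcases le_total 0 (s - 1) with hs | hs
        · calc c * ((2 : ℝ) ^ N) ^ (s - 1) ≤ 1 * ((2 : ℝ) ^ N) ^ (s - 1) := by gcongr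
            _ ≤ _ := by rw [one_mul]; exact Real.rpow_le_rpow (by positivity) h1 hs
        · calc c * ((2 : ℝ) ^ N) ^ (s - 1) ≤ 2 ^ (s - 1) * ((2 : ℝ) ^ N) ^ (s - 1) := by gcongr
            _ = (2 ^ N * 2) ^ (s - 1) := by
              rw [Real.mul_rpow (by positivity) (by norm_num), mul_comm]
            _ ≤ _ := Real.rpow_le_rpow_of_nonpos (by positivity) h2 hs
      refine le_trans (le_of_eq ?_) (Finset.card_nsmul_le_sum _ _ _ hb)
      have : 2 ^ (N + 1) - 2 ^ N = 2 ^ N := by rw [pow_succ]; omega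
      rw [Nat.card_Ico, this, nsmul_eq_mul]
      have h3 : (2 : ℝ) ^ ((N : ℝ) * s) = 2 ^ N * 2 ^ ((N : ℝ) * (s - 1)) := by
        rw [← Real.rpow_natCast 2 N, ← Real.rpow_add (by norm_num)]
        congr 1; ring
      rw [h3]; push_cast; ring
  have hs : Summable fun n : ℕ => c * ((2 : ℝ) ^ ((n : ℝ) * s) * u (2 ^ (n + 1))) := by
    refine summable_of_sum_range_le (c := ∑' k : ℕ, ((k : ℝ) + 1) ^ (s - 1) * u k)
      (fun n => mul_nonneg hc.le (mul_nonneg (by positivity) (h0 _))) fun N => ?_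
    exact (key N).trans (h.sum_le_tsum _ fun i _ => hv i)
  have hs2 := hs.mul_left (c⁻¹ * 2 ^ (3 * s))
  refine hs2.congr fun n => ?_
  have h4 : 2 ^ (n + 3) / 4 = 2 ^ (n + 1) := by
    rw [show 2 ^ (n + 3) = 2 ^ (n + 1) * 4 by ring]; simp
  have h5 : (2 : ℝ) ^ (((n + 3 : ℕ) : ℝ) * s) = 2 ^ (3 * s) * 2 ^ ((n : ℝ) * s) := by
    rw [← Real.rpow_add (by norm_num)]; congr 1; push_cast; ring
  rw [h4, h5]
  field_simp

theorem rn_ell (e : ℕ → ℝ) (he : Antitone e) (h0 : ∀ n, 0 ≤ e n) (ρ : ℝ) (hρ : 0 < ρ)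
    (μ : ℝ≥0∞) (hμ : 0 < μ)
    (h : MemEllMu μ fun n => ((n : ℝ) + 1) ^ (ρ - (μ⁻¹).toReal) * e n) :
    MemEllMu μ fun n => (2 : ℝ) ^ ((n : ℝ) * ρ) * e (2 ^ n / 4) := by
  unfold MemEllMu at *
  split_ifs at * with hi
  · subst hi
    obtain ⟨M, hM⟩ := h
    refine ⟨4 ^ ρ * M, fun n => ?_⟩
    have h1 := (le_abs_self _).trans (hM (2 ^ n / 4))
    simp only [ENNReal.inv_top, ENNReal.toReal_zero, sub_zero] at h1
    rw [abs_of_nonneg (mul_nonneg (by positivity) (h0 _))]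
    refine le_trans ?_ (mul_le_mul_of_nonneg_left h1 (by positivity))
    rw [← mul_assoc]
    refine mul_le_mul_of_nonneg_right ?_ (h0 _)
    rw [← Real.mul_rpow (by norm_num) (by positivity), Real.rpow_mul (by norm_num),
      Real.rpow_natCast]
    refine Real.rpow_le_rpow (by positivity) ?_ hρ.le
    have : 2 ^ n ≤ 4 * (2 ^ n / 4 + 1) := by omega
    exact_mod_cast this
  · have hp : 0 < μ.toReal := ENNReal.toReal_pos hμ.ne' hi
    set p := μ.toReal with hpdef
    have hs := rn_cond (fun n => e n ^ p)
      (fun a b hab => Real.rpow_le_rpow (h0 _) (he hab) hp.le)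
      (fun n => Real.rpow_nonneg (h0 n) p) (ρ * p) (h.congr fun n => ?_)
    · refine hs.congr fun n => ?_
      rw [abs_of_nonneg (mul_nonneg (by positivity) (h0 _)),
        Real.mul_rpow (by positivity) (h0 _), ← Real.rpow_mul (by norm_num), mul_assoc]
    · rw [abs_of_nonneg (mul_nonneg (by positivity) (h0 _)),
        Real.mul_rpow (by positivity) (h0 _), ← Real.rpow_mul (by positivity),
        ENNReal.toReal_inv, ← hpdef, sub_mul, inv_mul_cancel₀ hp.ne']

theorem rn_mem_of_le (μ : ℝ≥0∞) (hμ : 0 < μ) (x z : ℕ → ℝ) (hx : ∀ n, 0 ≤ x n)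
    (hz : ∀ n, 0 ≤ z n) (h : MemEllMu μ x)
    (hle : ∀ n, z n ≤ 2 * (x n + (1 / 2) ^ n)) : MemEllMu μ z := by
  unfold MemEllMu at *
  split_ifs at * with hi
  · obtain ⟨M, hM⟩ := h
    refine ⟨2 * (M + 1), fun n => ?_⟩
    rw [abs_of_nonneg (hz n)]
    have h1 := (le_abs_self _).trans (hM n)
    have h2 : (1 / 2 : ℝ) ^ n ≤ 1 := pow_le_one₀ (by norm_num) (by norm_num)
    linarith [hle n]
  · have hp : 0 < μ.toReal := ENNReal.toReal_pos hμ.ne' hi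
    set p := μ.toReal
    have hg : Summable fun n : ℕ => ((1 / 2 : ℝ) ^ p) ^ n :=
      summable_geometric_of_lt_one (by positivity)
        (Real.rpow_lt_one (by norm_num) (by norm_num) hp)
    refine Summable.of_nonneg_of_le (fun n => by positivity) (fun n => ?_)
      ((h.add hg).mul_left (4 ^ p))
    rw [abs_of_nonneg (hz n), abs_of_nonneg (hx n)]
    have h3 : ((1 / 2 : ℝ) ^ p) ^ n = ((1 / 2 : ℝ) ^ n) ^ p := by
      rw [← Real.rpow_natCast, ← Real.rpow_natCast, ← Real.rpow_mul (by norm_num),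
        ← Real.rpow_mul (by norm_num), mul_comm]
    rw [h3]
    set y := (1 / 2 : ℝ) ^ n with hy
    have hy0 : 0 ≤ y := by positivity
    have hxp := Real.rpow_nonneg (hx n) p
    have hyp := Real.rpow_nonneg hy0 p
    have h4 : (0 : ℝ) ≤ 4 ^ p := by positivity
    rcases le_total (x n) y with hxy | hxy
    · calc z n ^ p ≤ (4 * y) ^ p := Real.rpow_le_rpow (hz n) (by linarith [hle n]) hp.le
        _ = 4 ^ p * y ^ p := Real.mul_rpow (by norm_num) hy0
        _ ≤ _ := mul_le_mul_of_nonneg_left (by linarith) h4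
    · calc z n ^ p ≤ (4 * x n) ^ p := Real.rpow_le_rpow (hz n) (by linarith [hle n]) hp.le
        _ = 4 ^ p * x n ^ p := Real.mul_rpow (by norm_num) (hx n)
        _ ≤ _ := mul_le_mul_of_nonneg_left (by linarith) h4

/-- **Representation theorem (necessity).** For an approximation scheme on a Banach
space `X`, `0 < ρ < ∞` and `0 < μ ≤ ∞`: if `(n^{ρ - 1/μ} α_n(f, X)) ∈ ℓ_μ`, then there
are `g n ∈ A (2^n)` with `f = Σ_{n} g n` (convergence in `X`) and
`(2^{nρ} ‖g n‖) ∈ ℓ_μ`.  (Here `approxError S f n = α_{n+1}(f, X)`, and `ρ - 1/μ`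
is `ρ` when `μ = ∞`.) -/
theorem representation_necessity [CompleteSpace X] (S : ApproximationScheme X)
    (ρ : ℝ) (hρ : 0 < ρ) (μ : ℝ≥0∞) (hμ : 0 < μ) (f : X)
    (h : MemEllMu μ fun n =>
      ((n : ℝ) + 1) ^ (ρ - (μ⁻¹).toReal) * approxError S f n) :
    ∃ g : ℕ → X, (∀ n : ℕ, g n ∈ S.A (2 ^ n)) ∧
      Filter.Tendsto (fun N : ℕ => ∑ n ∈ Finset.range N, g n) Filter.atTop (nhds f) ∧
      MemEllMu μ fun n => (2 : ℝ) ^ ((n : ℝ) * ρ) * ‖g n‖ := by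
  have hδ : ∀ n : ℕ, 0 < (1 / 2 : ℝ) ^ n * 2 ^ (-((n : ℝ) * ρ)) := fun n => by positivity
  choose b hbA hb using fun n : ℕ => rn_exists S f (2 ^ n / 4) _ (hδ n)
  have hb0 : b 0 = 0 := by
    have := hbA 0
    simpa [S.zero_eq] using this
  have hm : Monotone fun n : ℕ => 2 ^ n / 4 := fun a c hac =>
    Nat.div_le_div_right (Nat.pow_le_pow_right (by norm_num) hac)
  have hδ1 : ∀ n : ℕ, (2 : ℝ) ^ (-((n : ℝ) * ρ)) ≤ 1 := fun n =>
    Real.rpow_le_one_of_one_le_of_nonpos (by norm_num)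
      (neg_nonpos.2 (mul_nonneg (Nat.cast_nonneg n) hρ.le))
  refine ⟨fun n => b (n + 1) - b n, fun n => ?_, ?_, ?_⟩
  · have h1 := S.add_mem _ _ _ (hbA (n + 1)) _ (S.smul_mem (-1) _ _ (hbA n))
    rw [neg_one_smul, ← sub_eq_add_neg] at h1
    refine rn_mono S ?_ h1
    rw [pow_succ]; omega
  · simp only [Finset.sum_range_sub, hb0, sub_zero]
    rw [tendsto_iff_norm_sub_tendsto_zero]
    have hmt : Filter.Tendsto (fun n : ℕ => 2 ^ n / 4) Filter.atTop Filter.atTop :=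
      (Nat.tendsto_div_const_atTop (by norm_num)).comp
        (tendsto_pow_atTop_atTop_of_one_lt (by norm_num : 1 < 2))
    have h1 := ((rn_tendsto S f).comp hmt).add (tendsto_pow_atTop_nhds_zero_of_lt_one
      (by norm_num : (0 : ℝ) ≤ 1 / 2) (by norm_num))
    rw [add_zero] at h1
    refine squeeze_zero (fun n => norm_nonneg _) (fun n => ?_) h1
    rw [norm_sub_rev]
    refine (hb n).trans (add_le_add le_rfl ?_)
    exact mul_le_of_le_one_right (by positivity) (hδ1 n)
  · refine rn_mem_of_le μ hμ _ _ (fun n => mul_nonneg (by positivity) (rn_nonneg S f _))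
      (fun n => by positivity)
      (rn_ell _ (rn_anti S f) (rn_nonneg S f) ρ hρ μ hμ h) fun n => ?_
    have h1 : ‖b (n + 1) - b n‖ ≤ ‖f - b n‖ + ‖f - b (n + 1)‖ := by
      have := norm_sub_le (f - b n) (f - b (n + 1))
      simpa using this
    have h2 : approxError S f (2 ^ (n + 1) / 4) ≤ approxError S f (2 ^ n / 4) :=
      rn_anti S f (hm (Nat.le_succ n))
    have h3 : (1 / 2 : ℝ) ^ (n + 1) * 2 ^ (-(((n + 1 : ℕ) : ℝ) * ρ)) ≤
        (1 / 2 : ℝ) ^ n * 2 ^ (-((n : ℝ) * ρ)) := by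
      refine mul_le_mul (pow_le_pow_of_le_one (by norm_num) (by norm_num) (Nat.le_succ n))
        (Real.rpow_le_rpow_of_exponent_le (by norm_num) ?_) (by positivity) (by positivity)
      push_cast; nlinarith
    have h4 : ‖b (n + 1) - b n‖ ≤
        2 * (approxError S f (2 ^ n / 4) + (1 / 2 : ℝ) ^ n * 2 ^ (-((n : ℝ) * ρ))) := by
      linarith [hb n, hb (n + 1)]
    refine (mul_le_mul_of_nonneg_left h4 (by positivity)).trans (le_of_eq ?_)
    rw [Real.rpow_neg (by norm_num)]
    have : (2 : ℝ) ^ ((n : ℝ) * ρ) ≠ 0 := by positivity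
    field_simp
end

section
/- Let X be a Banach space with an approximation scheme (A_n), and let Y be a linear subspace of X containing ⋃_n A_n, equipped with its own complete norm ‖·‖_Y making the inclusion Y → X continuous. Fix r > 0 and suppose the Jackson inequality holds: there is C₁ > 0 with α_n(f, X) ≤ C₁ n^{−r} ‖f‖_Y for all f ∈ Y and n ≥ 1; and the Bernstein inequality holds: there is C₂ > 0 with ‖g‖_Y ≤ C₂ n^{r} ‖g‖_X for all g ∈ A_n and n ≥ 1. Then for every 0 < ρ < r and 0 < μ ≤ ∞, the approximation space X^ρ_μ coincides with the real interpolation space (X, Y)_{ρ/r, μ}, with equivalence of the corresponding (quasi-)norms. -/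
open scoped ENNReal

variable {X : Type*} [NormedAddCommGroup X] [NormedSpace ℂ X]

/-- The approximation-space quasi-norm `‖f‖_{X^ρ_μ} = ‖(n^{ρ - 1/μ} α_n(f, X))_n‖_{ℓ_μ}`,
valued in `ℝ≥0∞` (the exponent `ρ - 1/μ` is `ρ` when `μ = ∞`). -/
noncomputable def apNorm (S : ApproximationScheme X) (ρ : ℝ) (μ : ℝ≥0∞) (f : X) : ℝ≥0∞ :=
  if μ = ∞ then ⨆ n : ℕ, ENNReal.ofReal (((n : ℝ) + 1) ^ ρ * approxError S f n)
  else (∑' n : ℕ, ENNReal.ofReal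
      ((((n : ℝ) + 1) ^ (ρ - (μ⁻¹).toReal) * approxError S f n) ^ μ.toReal)) ^
    (1 / μ.toReal)

section PairY

variable {Y : Type*} [NormedAddCommGroup Y] [NormedSpace ℂ Y]

/-- The K-functional of the pair `(X, Y)` where `Y` embeds into `X` via `j`:
`K(f, t) = inf {‖f - g‖_X + t ‖g‖_Y : g ∈ Y}`. -/
noncomputable def KfunXY (j : Y →L[ℂ] X) (f : X) (t : ℝ) : ℝ :=
  sInf {c : ℝ | ∃ g : Y, c = ‖f - j g‖ + t * ‖g‖}

/-- The real-interpolation (quasi-)norm `‖f‖_{θ,μ}` of the pair `(X, Y)`,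
valued in `ℝ≥0∞`. -/
noncomputable def interpNormXY (j : Y →L[ℂ] X) (θ : ℝ) (μ : ℝ≥0∞) (f : X) : ℝ≥0∞ :=
  if μ = ∞ then ⨆ t ∈ Set.Ioi (0 : ℝ), ENNReal.ofReal (t ^ (-θ) * KfunXY j f t)
  else (∫⁻ t in Set.Ioi (0 : ℝ),
      ENNReal.ofReal ((t ^ (-θ) * KfunXY j f t) ^ μ.toReal / t)) ^ (1 / μ.toReal)

end PairY

namespace ApproxAux

section E
variable (S : ApproximationScheme X)

lemma zero_mem (n : ℕ) : (0 : X) ∈ S.A n := by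
  induction n with
  | zero => rw [S.zero_eq]; simp
  | succ k ih => exact S.mono k ih

lemma A_mono : Monotone S.A := monotone_nat_of_le_succ S.mono

lemma bdd (f : X) (n : ℕ) : BddBelow {c : ℝ | ∃ a ∈ S.A n, c = ‖f - a‖} :=
  ⟨0, by rintro c ⟨a, -, rfl⟩; positivity⟩

lemma ne (f : X) (n : ℕ) : {c : ℝ | ∃ a ∈ S.A n, c = ‖f - a‖}.Nonempty :=
  ⟨_, 0, zero_mem S n, rfl⟩

lemma err_nonneg (f : X) (n : ℕ) : 0 ≤ approxError S f n := by
  apply Real.sInf_nonneg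
  rintro c ⟨a, -, rfl⟩; positivity

lemma err_le (f : X) (n : ℕ) {a : X} (ha : a ∈ S.A n) : approxError S f n ≤ ‖f - a‖ :=
  csInf_le (bdd S f n) ⟨a, ha, rfl⟩

lemma err_zero (f : X) : approxError S f 0 = ‖f‖ := by
  apply le_antisymm
  · simpa using err_le S f 0 (zero_mem S 0)
  · apply le_csInf (ne S f 0)
    rintro c ⟨a, ha, rfl⟩
    rw [S.zero_eq] at ha
    rw [Set.mem_singleton_iff.1 ha]; simp

lemma err_anti (f : X) : Antitone (approxError S f) := by
  intro m n h
  apply le_csInf (ne S f m)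
  rintro c ⟨a, ha, rfl⟩
  exact err_le S f n (A_mono S h ha)

lemma err_near (f : X) (n : ℕ) {ε : ℝ} (hε : 0 < ε) :
    ∃ a ∈ S.A n, ‖f - a‖ ≤ approxError S f n + ε := by
  obtain ⟨c, ⟨a, ha, rfl⟩, hc⟩ := exists_lt_of_csInf_lt (ne S f n)
    (show sInf {c : ℝ | ∃ a ∈ S.A n, c = ‖f - a‖} < approxError S f n + ε from
      lt_add_of_pos_right _ hε)
  exact ⟨a, ha, hc.le⟩

lemma err_add (f g : X) (n : ℕ) : approxError S f n ≤ ‖f - g‖ + approxError S g n := by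
  rw [← sub_le_iff_le_add']
  apply le_csInf (ne S g n)
  rintro c ⟨a, ha, rfl⟩
  have h1 := err_le S f n ha
  have h2 : ‖f - a‖ ≤ ‖f - g‖ + ‖g - a‖ := norm_sub_le_norm_sub_add_norm_sub f g a
  linarith

end E

section K
variable {Y : Type*} [NormedAddCommGroup Y] [NormedSpace ℂ Y] (j : Y →L[ℂ] X)

lemma K_ne (f : X) (t : ℝ) : {c : ℝ | ∃ g : Y, c = ‖f - j g‖ + t * ‖g‖}.Nonempty :=
  ⟨_, 0, rfl⟩

lemma K_nonneg (f : X) {t : ℝ} (ht : 0 ≤ t) : 0 ≤ KfunXY j f t := by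
  apply Real.sInf_nonneg
  rintro c ⟨a, rfl⟩; positivity

lemma K_le (f : X) {t : ℝ} (ht : 0 ≤ t) (g : Y) : KfunXY j f t ≤ ‖f - j g‖ + t * ‖g‖ :=
  csInf_le ⟨0, by rintro c ⟨a, rfl⟩; positivity⟩ ⟨g, rfl⟩

lemma K_le_norm (f : X) {t : ℝ} (ht : 0 ≤ t) : KfunXY j f t ≤ ‖f‖ := by
  simpa using K_le j f ht 0

lemma K_mono (f : X) {s t : ℝ} (hs : 0 ≤ s) (h : s ≤ t) : KfunXY j f s ≤ KfunXY j f t := by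
  apply le_csInf (K_ne j f t)
  rintro c ⟨g, rfl⟩
  refine (K_le j f hs g).trans ?_
  gcongr

lemma K_quasi (f : X) {s t : ℝ} (hs : 0 < s) (h : s ≤ t) :
    s / t * KfunXY j f t ≤ KfunXY j f s := by
  have ht : 0 < t := hs.trans_le h
  apply le_csInf (K_ne j f s)
  rintro c ⟨g, rfl⟩
  have h1 := K_le j f ht.le g
  calc s / t * KfunXY j f t ≤ s / t * (‖f - j g‖ + t * ‖g‖) := by gcongr
    _ = s / t * ‖f - j g‖ + s * ‖g‖ := by field_simp
    _ ≤ 1 * ‖f - j g‖ + s * ‖g‖ := by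
      gcongr
      exact (div_le_one ht).2 h
    _ = _ := by ring

lemma jackson_K (S : ApproximationScheme X) {r C₁ : ℝ} (hC₁ : 0 < C₁)
    (jackson : ∀ (g : Y) (n : ℕ), approxError S (j g) n ≤ C₁ * ((n : ℝ) + 1) ^ (-r) * ‖g‖)
    (f : X) (n : ℕ) :
    approxError S f n ≤ (1 + C₁) * KfunXY j f (((n : ℝ) + 1) ^ (-r)) := by
  rw [← div_le_iff₀' (by positivity)]
  apply le_csInf (K_ne j f _)
  rintro c ⟨g, rfl⟩
  rw [div_le_iff₀' (by positivity)]
  have h1 := err_add S f (j g) n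
  have h2 := jackson g n
  have h3 : 0 ≤ ((n : ℝ) + 1) ^ (-r) * ‖g‖ := by positivity
  have h4 := norm_nonneg (f - j g)
  nlinarith

lemma bernstein_K (S : ApproximationScheme X) (hA : ∀ n : ℕ, S.A n ⊆ Set.range j)
    {r C₂ : ℝ} (hC₂ : 0 < C₂)
    (bernstein : ∀ n : ℕ, 1 ≤ n → ∀ g : Y, j g ∈ S.A n → ‖g‖ ≤ C₂ * (n : ℝ) ^ r * ‖j g‖)
    (hj : Function.Injective j)
    (f : X) {t : ℝ} (ht : 0 ≤ t) (k : ℕ) :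
    KfunXY j f t ≤ approxError S f (2 ^ k - 1) +
      t * ∑ m ∈ Finset.range k, C₂ * ((2 : ℝ) ^ r) ^ (m + 2) *
        (2 * approxError S f (2 ^ m - 1)) := by
  set a : ℕ → ℝ := fun m => approxError S f (2 ^ m - 1) with ha
  have anti : ∀ m, a (m + 1) ≤ a m := by
    intro m
    apply err_anti S f
    have : 2 ^ m ≤ 2 ^ (m + 1) := Nat.pow_le_pow_right (by norm_num) (by omega)
    omega
  set R : ℝ := 1 + t * ∑ m ∈ Finset.range k, C₂ * ((2 : ℝ) ^ r) ^ (m + 2) * 2 with hR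
  have hRpos : 0 < R := by positivity
  apply le_of_forall_pos_le_add
  intro η hη
  set ε := η / R with hε
  have hεpos : 0 < ε := by positivity
  choose g hgA hg using fun m : ℕ => err_near S f (2 ^ m - 1) hεpos
  choose G hG using fun m : ℕ => hA _ (hgA m)
  have hG0 : G 0 = 0 := by
    apply hj
    rw [hG, map_zero]
    have := hgA 0
    simpa [S.zero_eq] using this
  have hstep : ∀ m, ‖G (m + 1) - G m‖ ≤ C₂ * ((2 : ℝ) ^ r) ^ (m + 2) * (2 * a m + 2 * ε) := by
    intro m
    have hmem : j (G (m + 1) - G m) ∈ S.A (2 ^ (m + 2)) := by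
      rw [map_sub, hG, hG]
      have h1 := S.add_mem _ _ _ (hgA (m + 1)) _ (S.smul_mem (-1) _ _ (hgA m))
      have h2 : g (m + 1) - g m = g (m + 1) + (-1 : ℂ) • g m := by
        rw [neg_one_smul, sub_eq_add_neg]
      rw [h2]
      refine A_mono S ?_ h1
      have e1 : 2 ^ (m + 1) = 2 ^ m * 2 := pow_succ (2 : ℕ) m
      have e2 : 2 ^ (m + 2) = 2 ^ (m + 1) * 2 := pow_succ (2 : ℕ) (m + 1)
      omega
    have h1 := bernstein _ Nat.one_le_two_pow _ hmem
    refine h1.trans ?_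
    have h2 : (((2 ^ (m + 2) : ℕ) : ℝ)) ^ r = ((2 : ℝ) ^ r) ^ (m + 2) := by
      push_cast
      rw [← Real.rpow_natCast, ← Real.rpow_natCast, ← Real.rpow_mul (by norm_num),
        ← Real.rpow_mul (by norm_num), mul_comm]
    rw [h2]
    gcongr
    rw [map_sub, hG, hG]
    have h3 : ‖g (m + 1) - g m‖ ≤ ‖f - g (m + 1)‖ + ‖f - g m‖ := by
      have : g (m + 1) - g m = (f - g m) - (f - g (m + 1)) := by abel
      rw [this]
      exact (norm_sub_le _ _).trans_eq (add_comm _ _)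
    have h4 := hg m
    have h5 := hg (m + 1)
    have h6 := anti m
    simp only [ha] at h6 ⊢
    linarith
  have hsum : ‖G k‖ ≤ ∑ m ∈ Finset.range k,
      C₂ * ((2 : ℝ) ^ r) ^ (m + 2) * (2 * a m + 2 * ε) := by
    have h1 : G k = ∑ m ∈ Finset.range k, (G (m + 1) - G m) := by
      rw [Finset.sum_range_sub, hG0, sub_zero]
    rw [h1]
    exact (norm_sum_le _ _).trans (Finset.sum_le_sum fun m _ => hstep m)
  have h1 := K_le j f ht (G k)
  rw [hG] at h1
  have h2 := hg k
  have h3 : t * ‖G k‖ ≤ t * ∑ m ∈ Finset.range k,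
      C₂ * ((2 : ℝ) ^ r) ^ (m + 2) * (2 * a m + 2 * ε) := by gcongr
  have h4 : η = ε + t * ∑ m ∈ Finset.range k, C₂ * ((2 : ℝ) ^ r) ^ (m + 2) * (2 * ε) := by
    have : η = ε * R := by rw [hε]; field_simp
    rw [this, hR, mul_add, mul_one, mul_left_comm, Finset.mul_sum]
    congr 2
    apply Finset.sum_congr rfl
    intros; ring
  have h5 : ∑ m ∈ Finset.range k, C₂ * ((2 : ℝ) ^ r) ^ (m + 2) * (2 * a m + 2 * ε)
      = ∑ m ∈ Finset.range k, C₂ * ((2 : ℝ) ^ r) ^ (m + 2) * (2 * a m)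
      + ∑ m ∈ Finset.range k, C₂ * ((2 : ℝ) ^ r) ^ (m + 2) * (2 * ε) := by
    rw [← Finset.sum_add_distrib]
    apply Finset.sum_congr rfl
    intros; ring
  rw [h5, mul_add] at h3
  linarith

end K
open Finset in
lemma hardy_point (b : ℕ → ℝ≥0∞) (x : ℝ≥0∞) (hx0 : x ≠ 0) (hx : x < 1) {p : ℝ} (hp : 0 < p)
    (k : ℕ) :
    (∑ m ∈ range (k + 1), x ^ (2 * (k - m)) * b m) ≤
      (1 - x)⁻¹ * (∑ m ∈ range (k + 1), (x ^ p) ^ (k - m) * b m ^ p) ^ (1 / p) := by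
  set TT := ∑ m ∈ range (k + 1), (x ^ p) ^ (k - m) * b m ^ p with hS
  have hxt : x ≠ ∞ := (hx.trans ENNReal.one_lt_top).ne
  have h1 : ∀ m ∈ range (k + 1), x ^ (k - m) * b m ≤ TT ^ (1 / p) := by
    intro m hm
    have h2 : (x ^ (k - m) * b m) ^ p ≤ TT := by
      rw [ENNReal.mul_rpow_of_nonneg _ _ hp.le]
      have : (x ^ (k - m)) ^ p = (x ^ p) ^ (k - m) := by
        rw [← ENNReal.rpow_natCast, ← ENNReal.rpow_natCast, ← ENNReal.rpow_mul,
          ← ENNReal.rpow_mul, mul_comm]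
      rw [this]
      exact single_le_sum (f := fun m => (x ^ p) ^ (k - m) * b m ^ p)
        (fun _ _ => zero_le) hm
    calc x ^ (k - m) * b m = ((x ^ (k - m) * b m) ^ p) ^ (1 / p) := by
          rw [← ENNReal.rpow_mul, mul_one_div_cancel hp.ne', ENNReal.rpow_one]
      _ ≤ _ := ENNReal.rpow_le_rpow h2 (by positivity)
  calc (∑ m ∈ range (k + 1), x ^ (2 * (k - m)) * b m)
      ≤ ∑ m ∈ range (k + 1), x ^ (k - m) * TT ^ (1 / p) := by
        apply sum_le_sum
        intro m hm
        rw [two_mul, pow_add, mul_assoc]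
        gcongr
        exact h1 m hm
    _ = (∑ m ∈ range (k + 1), x ^ (k - m)) * TT ^ (1 / p) := by rw [sum_mul]
    _ ≤ _ := by
        gcongr
        rw [← ENNReal.tsum_geometric]
        have := sum_range_reflect (fun i => x ^ i) (k + 1)
        simp only [Nat.add_sub_cancel] at this
        rw [this]
        exact ENNReal.sum_le_tsum _

open Finset in
lemma hardy (b c : ℕ → ℝ≥0∞) (x : ℝ≥0∞) (hx0 : x ≠ 0) (hx : x < 1) {p : ℝ} (hp : 0 < p)
    (D : ℝ≥0∞)
    (hc : ∀ k, c k ≤ D * ∑ m ∈ range (k + 1), x ^ (2 * (k - m)) * b m) :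
    ∑' k, c k ^ p ≤ (D * (1 - x)⁻¹) ^ p * (1 - x ^ p)⁻¹ * ∑' m, b m ^ p := by
  have h1 : ∀ k, c k ^ p ≤ (D * (1 - x)⁻¹) ^ p *
      ∑ m ∈ range (k + 1), (x ^ p) ^ (k - m) * b m ^ p := by
    intro k
    have h2 := (hc k).trans (mul_le_mul_right (hardy_point b x hx0 hx hp k) D)
    have h3 := ENNReal.rpow_le_rpow h2 hp.le
    refine h3.trans_eq ?_
    rw [← mul_assoc, ENNReal.mul_rpow_of_nonneg _ _ hp.le, ← ENNReal.rpow_mul,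
      one_div_mul_cancel hp.ne', ENNReal.rpow_one]
  calc ∑' k, c k ^ p ≤ ∑' k, (D * (1 - x)⁻¹) ^ p *
      ∑ m ∈ range (k + 1), (x ^ p) ^ (k - m) * b m ^ p := ENNReal.tsum_le_tsum h1
    _ = (D * (1 - x)⁻¹) ^ p * ∑' k,
      ∑ m ∈ range (k + 1), (x ^ p) ^ (k - m) * b m ^ p := ENNReal.tsum_mul_left
    _ ≤ (D * (1 - x)⁻¹) ^ p * ((1 - x ^ p)⁻¹ * ∑' m, b m ^ p) := by
      gcongr
      calc ∑' k, ∑ m ∈ range (k + 1), (x ^ p) ^ (k - m) * b m ^ p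
          = ∑' k, ∑' m, if m ≤ k then (x ^ p) ^ (k - m) * b m ^ p else 0 := by
            congr 1; ext k
            rw [tsum_eq_sum (s := range (k + 1))]
            · apply sum_congr rfl
              intro m hm
              rw [if_pos (by simpa [Nat.lt_succ_iff] using hm)]
            · intro m hm
              rw [if_neg (by simpa [Nat.lt_succ_iff] using hm)]
        _ = ∑' m, ∑' k, if m ≤ k then (x ^ p) ^ (k - m) * b m ^ p else 0 := ENNReal.tsum_comm
        _ = ∑' m, (1 - x ^ p)⁻¹ * b m ^ p := by
            congr 1; ext m
            rw [← Summable.sum_add_tsum_nat_add' (k := m) ENNReal.summable]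
            rw [sum_eq_zero]
            · simp only [le_add_iff_nonneg_left, zero_le, if_true, Nat.add_sub_cancel, zero_add]
              rw [ENNReal.tsum_mul_right, ENNReal.tsum_geometric]
            · intro k hk
              rw [if_neg (by simpa using hk)]
        _ ≤ _ := by rw [ENNReal.tsum_mul_left]
    _ = _ := by rw [mul_assoc]

/-- dyadic block decomposition -/
lemma tsum_blocks (F : ℕ → ℝ≥0∞) :
    ∑' n, F n = ∑' k, ∑ n ∈ Finset.Ico (2 ^ k - 1) (2 ^ (k + 1) - 1), F n := by
  have h1 : ∀ n, F n = ∑' k, if Nat.log 2 (n + 1) = k then F n else 0 := by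
    intro n
    rw [tsum_eq_single (Nat.log 2 (n + 1)) (fun k hk => if_neg (Ne.symm hk)), if_pos rfl]
  have key : ∀ n k, Nat.log 2 (n + 1) = k ↔ n ∈ Finset.Ico (2 ^ k - 1) (2 ^ (k + 1) - 1) := by
    intro n k
    rw [Nat.log_eq_iff (Or.inr ⟨by norm_num, by omega⟩), Finset.mem_Ico]
    have : 1 ≤ 2 ^ k := Nat.one_le_two_pow
    omega
  calc ∑' n, F n = ∑' n, ∑' k, if Nat.log 2 (n + 1) = k then F n else 0 := tsum_congr h1
    _ = ∑' k, ∑' n, if Nat.log 2 (n + 1) = k then F n else 0 := ENNReal.tsum_comm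
    _ = _ := by
      congr 1; ext k
      rw [tsum_eq_sum (s := Finset.Ico (2 ^ k - 1) (2 ^ (k + 1) - 1))]
      · apply Finset.sum_congr rfl
        intro n hn
        rw [if_pos ((key n k).2 hn)]
      · intro n hn
        rw [if_neg (fun h => hn ((key n k).1 h))]

lemma block_card (k : ℕ) : (Finset.Ico (2 ^ k - 1) (2 ^ (k + 1) - 1)).card = 2 ^ k := by
  have : 1 ≤ 2 ^ k := Nat.one_le_two_pow
  have := pow_succ 2 k
  rw [Nat.card_Ico]; omega

/-- `∑ (n+1)^(ρp-1) E_n^p` compared with the dyadic sum. -/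
lemma term_eq {ρ p e N : ℝ} (hp : 0 < p) (he : 0 ≤ e) (hN : 0 < N) :
    (N ^ (ρ - p⁻¹) * e) ^ p = (N ^ ρ * e) ^ p * N⁻¹ := by
  rw [Real.mul_rpow (by positivity) he, Real.mul_rpow (by positivity) he,
    ← Real.rpow_mul hN.le, ← Real.rpow_mul hN.le, sub_mul, inv_mul_cancel₀ hp.ne',
    Real.rpow_sub hN, Real.rpow_one]
  ring

lemma two_rpow_nat (ρ : ℝ) (k : ℕ) : ((2 : ℝ) ^ k) ^ ρ = ((2 : ℝ) ^ ρ) ^ k := by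
  rw [← Real.rpow_natCast, ← Real.rpow_natCast, ← Real.rpow_mul (by norm_num),
    ← Real.rpow_mul (by norm_num), mul_comm]

lemma ap_le_dyadic (e : ℕ → ℝ) (he : ∀ n, 0 ≤ e n) (hanti : Antitone e) {ρ p : ℝ} (hρ : 0 < ρ)
    (hp : 0 < p) :
    ∑' n : ℕ, ENNReal.ofReal ((((n : ℝ) + 1) ^ (ρ - p⁻¹) * e n) ^ p) ≤
      ENNReal.ofReal (((2 : ℝ) ^ ρ) ^ p) *
        ∑' k : ℕ, ENNReal.ofReal (((2 : ℝ) ^ ρ) ^ k * e (2 ^ k - 1)) ^ p := by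
  rw [tsum_blocks, ← ENNReal.tsum_mul_left]
  apply ENNReal.tsum_le_tsum
  intro k
  have hb : ∀ n : ℕ, n ∈ Finset.Ico (2 ^ k - 1) (2 ^ (k + 1) - 1) →
      ENNReal.ofReal ((((n : ℝ) + 1) ^ (ρ - p⁻¹) * e n) ^ p) ≤
      ENNReal.ofReal (((2 : ℝ) ^ ρ * (((2 : ℝ) ^ ρ) ^ k * e (2 ^ k - 1))) ^ p * ((2 : ℝ) ^ k)⁻¹) := by
    intro n hn
    rw [Finset.mem_Ico] at hn
    apply ENNReal.ofReal_le_ofReal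
    rw [term_eq hp (he n) (by positivity)]
    have hk1 : 1 ≤ 2 ^ k := Nat.one_le_two_pow
    have h1 : (2 : ℝ) ^ k ≤ (n : ℝ) + 1 := by
      have : 2 ^ k ≤ n + 1 := by omega
      exact_mod_cast this
    have h2 : (n : ℝ) + 1 ≤ (2 : ℝ) ^ (k + 1) := by
      have : n + 1 ≤ 2 ^ (k + 1) := by omega
      exact_mod_cast this
    have h3 : ((n : ℝ) + 1) ^ ρ ≤ (2 : ℝ) ^ ρ * ((2 : ℝ) ^ ρ) ^ k := by
      rw [← pow_succ', ← two_rpow_nat]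
      gcongr
    rw [← mul_assoc]
    have := he n
    have := he (2 ^ k - 1)
    gcongr
    exact hanti hn.1
  refine (Finset.sum_le_card_nsmul _ _ _ hb).trans_eq ?_
  have h0 := he (2 ^ k - 1)
  rw [block_card, nsmul_eq_mul, ENNReal.ofReal_rpow_of_nonneg (by positivity) hp.le,
    ← ENNReal.ofReal_natCast, ← ENNReal.ofReal_mul (by positivity),
    ← ENNReal.ofReal_mul (by positivity), Real.mul_rpow (by positivity) (by positivity)]
  congr 1
  push_cast
  field_simp

lemma dyadic_le_ap (e : ℕ → ℝ) (he : ∀ n, 0 ≤ e n) (hanti : Antitone e) {ρ p : ℝ} (hρ : 0 < ρ)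
    (hp : 0 < p) :
    ∑' k : ℕ, ENNReal.ofReal (((2 : ℝ) ^ ρ) ^ k * e (2 ^ k - 1)) ^ p ≤
      (1 + ENNReal.ofReal (((2 : ℝ) ^ ρ) ^ p * 2)) *
      ∑' n : ℕ, ENNReal.ofReal ((((n : ℝ) + 1) ^ (ρ - p⁻¹) * e n) ^ p) := by
  rw [tsum_eq_zero_add' ENNReal.summable, add_mul, one_mul]
  apply add_le_add
  · refine le_trans ?_ (ENNReal.le_tsum 0)
    have := he 0
    simp only [pow_zero, one_mul, tsub_self, CharP.cast_eq_zero, zero_add, Real.one_rpow]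
    rw [ENNReal.ofReal_rpow_of_nonneg this hp.le]
  rw [tsum_blocks (fun n : ℕ => ENNReal.ofReal ((((n : ℝ) + 1) ^ (ρ - p⁻¹) * e n) ^ p)),
    ← ENNReal.tsum_mul_left]
  apply ENNReal.tsum_le_tsum
  intro k
  have hb : ∀ n : ℕ, n ∈ Finset.Ico (2 ^ k - 1) (2 ^ (k + 1) - 1) →
      ENNReal.ofReal ((((2 : ℝ) ^ ρ) ^ k * e (2 ^ (k + 1) - 1)) ^ p * ((2 : ℝ) ^ (k + 1))⁻¹) ≤
      ENNReal.ofReal ((((n : ℝ) + 1) ^ (ρ - p⁻¹) * e n) ^ p) := by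
    intro n hn
    rw [Finset.mem_Ico] at hn
    apply ENNReal.ofReal_le_ofReal
    rw [term_eq hp (he n) (by positivity)]
    have hk1 : 1 ≤ 2 ^ k := Nat.one_le_two_pow
    have h1 : (2 : ℝ) ^ k ≤ (n : ℝ) + 1 := by
      have : 2 ^ k ≤ n + 1 := by omega
      exact_mod_cast this
    have h2 : (n : ℝ) + 1 ≤ (2 : ℝ) ^ (k + 1) := by
      have : n + 1 ≤ 2 ^ (k + 1) := by omega
      exact_mod_cast this
    rw [← two_rpow_nat]
    have := he n
    have := he (2 ^ (k + 1) - 1)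
    gcongr
    exact hanti hn.2.le
  have h0 := he (2 ^ (k + 1) - 1)
  refine le_trans (le_of_eq ?_) (mul_le_mul_right (Finset.card_nsmul_le_sum _ _ _ hb) _)
  rw [block_card, nsmul_eq_mul, ENNReal.ofReal_rpow_of_nonneg (by positivity) hp.le,
    ← ENNReal.ofReal_natCast, ← ENNReal.ofReal_mul (by positivity),
    ← ENNReal.ofReal_mul (by positivity), pow_succ' _ k, mul_assoc ((2 : ℝ) ^ ρ) _ _,
    Real.mul_rpow (by positivity) (by positivity)]
  congr 1
  push_cast
  field_simp
  ring
section Int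
open MeasureTheory Set

lemma pow_rpow_neg {y : ℝ} (hy : 0 < y) (θ : ℝ) (k : ℕ) : (y ^ k) ^ (-θ) = (y ^ (-θ)) ^ k := by
  rw [← Real.rpow_natCast, ← Real.rpow_natCast, ← Real.rpow_mul hy.le,
    ← Real.rpow_mul hy.le, mul_comm]

lemma Ioc_cover {y : ℝ} (hy : 0 < y) (hy1 : y < 1) {t : ℝ} (ht : 0 < t) (ht1 : t ≤ 1) :
    ∃ k : ℕ, t ∈ Ioc (y ^ (k + 1)) (y ^ k) := by
  obtain ⟨n, h1, h2⟩ := exists_nat_pow_near_of_lt_one ht ht1 hy hy1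
  exact ⟨n, h1, h2⟩

lemma int_upper (K : ℝ → ℝ) (hK : ∀ t, 0 ≤ t → 0 ≤ K t)
    (hmono : ∀ s t, 0 ≤ s → s ≤ t → K s ≤ K t) (N : ℝ) (hN : ∀ t, 0 ≤ t → K t ≤ N)
    {y θ p : ℝ} (hy : 0 < y) (hy1 : y < 1) (hθ : 0 < θ) (hp : 0 < p) :
    ∫⁻ t in Ioi (0 : ℝ), ENNReal.ofReal ((t ^ (-θ) * K t) ^ p / t) ≤
      ENNReal.ofReal ((y ^ (-θ)) ^ p * y⁻¹) *
        (∑' k : ℕ, ENNReal.ofReal ((y ^ (-θ)) ^ k * K (y ^ k)) ^ p) +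
      (∫⁻ t in Ioi (1 : ℝ), ENNReal.ofReal (t ^ (-θ * p - 1))) * ENNReal.ofReal N ^ p := by
  have hN0 : 0 ≤ N := (hK 0 le_rfl).trans (hN 0 le_rfl)
  have hsub : Ioi (0 : ℝ) ⊆ (⋃ k : ℕ, Ioc (y ^ (k + 1)) (y ^ k)) ∪ Ioi 1 := by
    intro t ht
    rcases le_or_gt t 1 with h | h
    · left
      rw [mem_iUnion]
      exact Ioc_cover hy hy1 ht h
    · right; exact h
  refine (lintegral_mono_set hsub).trans ((lintegral_union_le _ _ _).trans (add_le_add ?_ ?_))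
  · refine (lintegral_iUnion_le _ _).trans ?_
    rw [← ENNReal.tsum_mul_left]
    apply ENNReal.tsum_le_tsum
    intro k
    have h0 := hK (y ^ k) (by positivity)
    have hb : ∀ t ∈ Ioc (y ^ (k + 1)) (y ^ k), ENNReal.ofReal ((t ^ (-θ) * K t) ^ p / t) ≤
        ENNReal.ofReal (((y ^ (-θ)) ^ (k + 1) * K (y ^ k)) ^ p / y ^ (k + 1)) := by
      intro t ht
      have hy' : 0 < y ^ (k + 1) := by positivity
      have ht0 : 0 < t := hy'.trans ht.1
      have h1 := hK t ht0.le
      apply ENNReal.ofReal_le_ofReal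
      rw [← pow_rpow_neg hy]
      have h2 : t ^ (-θ) ≤ (y ^ (k + 1)) ^ (-θ) :=
        Real.rpow_le_rpow_of_nonpos hy' ht.1.le (by linarith)
      have h3 := hmono t _ ht0.le ht.2
      have h4 := ht.1.le
      gcongr
    refine (setLIntegral_mono' measurableSet_Ioc hb).trans ?_
    rw [setLIntegral_const, Real.volume_Ioc, ENNReal.ofReal_rpow_of_nonneg (by positivity) hp.le,
      ← ENNReal.ofReal_mul (by positivity), ← ENNReal.ofReal_mul (by positivity)]
    apply ENNReal.ofReal_le_ofReal
    rw [pow_succ' (y ^ (-θ)), mul_assoc, Real.mul_rpow (by positivity) (by positivity)]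
    calc _ ≤ (y ^ (-θ)) ^ p * ((y ^ (-θ)) ^ k * K (y ^ k)) ^ p / y ^ (k + 1) * y ^ k := by
          gcongr
          have : 0 < y ^ (k + 1) := by positivity
          linarith
      _ = _ := by field_simp; ring
  · have hb : ∀ t ∈ Ioi (1 : ℝ), ENNReal.ofReal ((t ^ (-θ) * K t) ^ p / t) ≤
        ENNReal.ofReal (t ^ (-θ * p - 1)) * ENNReal.ofReal N ^ p := by
      intro t ht
      have ht0 : (0 : ℝ) < t := zero_lt_one.trans ht
      have h1 := hK t ht0.le
      rw [ENNReal.ofReal_rpow_of_nonneg hN0 hp.le, ← ENNReal.ofReal_mul (by positivity)]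
      apply ENNReal.ofReal_le_ofReal
      rw [Real.mul_rpow (by positivity) h1, ← Real.rpow_mul ht0.le, Real.rpow_sub ht0,
        Real.rpow_one, mul_div_right_comm]
      gcongr
      exact hN t ht0.le
    refine (setLIntegral_mono' measurableSet_Ioi hb).trans_eq ?_
    rw [lintegral_mul_const]
    fun_prop

lemma J_lt_top {θ p : ℝ} (hθ : 0 < θ) (hp : 0 < p) :
    (∫⁻ t in Ioi (1 : ℝ), ENNReal.ofReal (t ^ (-θ * p - 1))) < ∞ := by
  apply Integrable.lintegral_lt_top
  apply integrableOn_Ioi_rpow_of_lt _ zero_lt_one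
  have := mul_pos hθ hp
  linarith

lemma int_lower (K : ℝ → ℝ) (hK : ∀ t, 0 ≤ t → 0 ≤ K t)
    (hq : ∀ s t, 0 < s → s ≤ t → s / t * K t ≤ K s)
    {y θ p : ℝ} (hy : 0 < y) (hy1 : y < 1) (hθ : 0 < θ) (hp : 0 < p) :
    ENNReal.ofReal (y ^ p * (1 - y)) *
        (∑' k : ℕ, ENNReal.ofReal ((y ^ (-θ)) ^ k * K (y ^ k)) ^ p) ≤
    ∫⁻ t in Ioi (0 : ℝ), ENNReal.ofReal ((t ^ (-θ) * K t) ^ p / t) := by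
  have hsub : (⋃ k : ℕ, Ioc (y ^ (k + 1)) (y ^ k)) ⊆ Ioi (0 : ℝ) := by
    intro t ht
    obtain ⟨k, hk⟩ := mem_iUnion.1 ht
    exact lt_of_le_of_lt (by positivity) hk.1
  have hanti : Antitone (fun k : ℕ => y ^ k) := pow_right_anti₀ hy.le hy1.le
  have hdis := hanti.pairwise_disjoint_on_Ioc_succ
  refine le_trans ?_ (lintegral_mono_set hsub)
  rw [lintegral_iUnion (fun k => measurableSet_Ioc) (by simpa using hdis),
    ← ENNReal.tsum_mul_left]
  apply ENNReal.tsum_le_tsum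
  intro k
  have h0 := hK (y ^ k) (by positivity)
  have hb : ∀ t ∈ Ioc (y ^ (k + 1)) (y ^ k),
      ENNReal.ofReal (((y ^ (-θ)) ^ k * (y * K (y ^ k))) ^ p / y ^ k) ≤
      ENNReal.ofReal ((t ^ (-θ) * K t) ^ p / t) := by
    intro t ht
    have hy' : 0 < y ^ (k + 1) := by positivity
    have ht0 : 0 < t := hy'.trans ht.1
    have h1 := hK t ht0.le
    apply ENNReal.ofReal_le_ofReal
    rw [← pow_rpow_neg hy]
    have h2 : (y ^ k) ^ (-θ) ≤ t ^ (-θ) :=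
      Real.rpow_le_rpow_of_nonpos ht0 ht.2 (by linarith)
    have h3 : y * K (y ^ k) ≤ K t := by
      refine le_trans ?_ (hq t _ ht0 ht.2)
      gcongr
      rw [le_div_iff₀ (by positivity), ← pow_succ']
      exact ht.1.le
    have h4 := ht.2
    gcongr
  refine le_trans ?_ (setLIntegral_mono' measurableSet_Ioc hb)
  rw [setLIntegral_const, Real.volume_Ioc, ENNReal.ofReal_rpow_of_nonneg (by positivity) hp.le,
    ← ENNReal.ofReal_mul (mul_nonneg (by positivity) (by linarith)),
    ← ENNReal.ofReal_mul (by positivity)]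
  apply ENNReal.ofReal_le_ofReal
  rw [mul_left_comm ((y ^ (-θ)) ^ k), Real.mul_rpow (x := y) (by positivity) (by positivity)]
  apply le_of_eq
  rw [pow_succ]
  field_simp

end Int
section Final
variable {Y : Type*} [NormedAddCommGroup Y] [NormedSpace ℂ Y] (j : Y →L[ℂ] X)

lemma rpow_conv {A I C : ℝ≥0∞} {p : ℝ} (hp : 0 < p) (h : A ≤ C * I) :
    A ^ (1 / p) ≤ C ^ (1 / p) * I ^ (1 / p) := by
  rw [← ENNReal.mul_rpow_of_nonneg _ _ (by positivity)]
  exact ENNReal.rpow_le_rpow h (by positivity)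

lemma y_pow {r : ℝ} (k : ℕ) : (((2 ^ k - 1 : ℕ) : ℝ) + 1) ^ (-r) = (((2 : ℝ) ^ r)⁻¹) ^ k := by
  have : 1 ≤ 2 ^ k := Nat.one_le_two_pow
  rw [Nat.cast_sub this]
  push_cast
  rw [sub_add_cancel, two_rpow_nat, Real.rpow_neg (by norm_num)]

lemma y_theta {r ρ : ℝ} (hr : 0 < r) : (((2 : ℝ) ^ r)⁻¹) ^ (-(ρ / r)) = (2 : ℝ) ^ ρ := by
  rw [← Real.rpow_neg (by norm_num), ← Real.rpow_mul (by norm_num)]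
  congr 1
  field_simp

/-- the key estimate in the form needed by the Hardy inequality -/
lemma kappa_le (S : ApproximationScheme X) (hA : ∀ n : ℕ, S.A n ⊆ Set.range j)
    {r ρ C₂ : ℝ} (hρr : ρ < r) (hC₂ : 0 < C₂)
    (bernstein : ∀ n : ℕ, 1 ≤ n → ∀ g : Y, j g ∈ S.A n → ‖g‖ ≤ C₂ * (n : ℝ) ^ r * ‖j g‖)
    (hj : Function.Injective j)
    (f : X) (k : ℕ) :
    ENNReal.ofReal (((2 : ℝ) ^ ρ) ^ k * KfunXY j f ((((2 : ℝ) ^ r)⁻¹) ^ k)) ≤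
      ENNReal.ofReal (1 + 2 * C₂ * ((2 : ℝ) ^ r) ^ 2) *
      ∑ m ∈ Finset.range (k + 1),
        (ENNReal.ofReal (√((2 : ℝ) ^ ρ / (2 : ℝ) ^ r))) ^ (2 * (k - m)) *
        ENNReal.ofReal (((2 : ℝ) ^ ρ) ^ m * approxError S f (2 ^ m - 1)) := by
  have hu : 0 < (2 : ℝ) ^ r := by positivity
  have hv : 0 < (2 : ℝ) ^ ρ := by positivity
  have hKb := bernstein_K j S hA hC₂ bernstein hj f
    (t := (((2 : ℝ) ^ r)⁻¹) ^ k) (by positivity) k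
  set u := (2 : ℝ) ^ r
  set v := (2 : ℝ) ^ ρ
  have hE := err_nonneg S f
  have hterm : ∀ m, (ENNReal.ofReal (√(v / u))) ^ (2 * (k - m)) *
        ENNReal.ofReal (v ^ m * approxError S f (2 ^ m - 1)) =
        ENNReal.ofReal ((v / u) ^ (k - m) * (v ^ m * approxError S f (2 ^ m - 1))) := by
    intro m
    rw [pow_mul, ← ENNReal.ofReal_pow (by positivity), Real.sq_sqrt (by positivity),
      ← ENNReal.ofReal_pow (by positivity), ← ENNReal.ofReal_mul (by positivity)]
  simp only [hterm]
  rw [← ENNReal.ofReal_sum_of_nonneg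
    (fun m _ => mul_nonneg (by positivity) (mul_nonneg (by positivity) (hE _))),
    ← ENNReal.ofReal_mul (by positivity)]
  apply ENNReal.ofReal_le_ofReal
  have hpow : ∀ m ∈ Finset.range k, v ^ k * (u⁻¹ ^ k * (C₂ * u ^ (m + 2) *
      (2 * approxError S f (2 ^ m - 1)))) =
      (2 * C₂ * u ^ 2) * ((v / u) ^ (k - m) * (v ^ m * approxError S f (2 ^ m - 1))) := by
    intro m hm
    obtain ⟨i, rfl⟩ := Nat.exists_eq_add_of_lt (Finset.mem_range.1 hm)
    have : m + i + 1 - m = i + 1 := by omega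
    rw [this, div_pow, inv_pow]
    field_simp
    ring
  have hsum : v ^ k * (u⁻¹ ^ k * ∑ m ∈ Finset.range k, C₂ * u ^ (m + 2) *
      (2 * approxError S f (2 ^ m - 1))) = (2 * C₂ * u ^ 2) *
      ∑ m ∈ Finset.range k, (v / u) ^ (k - m) * (v ^ m * approxError S f (2 ^ m - 1)) := by
    rw [Finset.mul_sum, Finset.mul_sum, Finset.mul_sum]
    exact Finset.sum_congr rfl hpow
  have h1 : v ^ k * KfunXY j f (u⁻¹ ^ k) ≤ v ^ k * (approxError S f (2 ^ k - 1) +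
      u⁻¹ ^ k * ∑ m ∈ Finset.range k, C₂ * u ^ (m + 2) *
      (2 * approxError S f (2 ^ m - 1))) := by gcongr
  rw [mul_add, hsum] at h1
  refine h1.trans ?_
  rw [Finset.sum_range_succ, Nat.sub_self, pow_zero, one_mul]
  have h2 : 0 ≤ ∑ m ∈ Finset.range k,
      (v / u) ^ (k - m) * (v ^ m * approxError S f (2 ^ m - 1)) :=
    Finset.sum_nonneg
      (fun m _ => mul_nonneg (by positivity) (mul_nonneg (by positivity) (hE _)))
  have h3 : 0 ≤ v ^ k * approxError S f (2 ^ k - 1) := mul_nonneg (by positivity) (hE _)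
  have h4 : 0 ≤ 2 * C₂ * u ^ 2 := by positivity
  nlinarith [mul_nonneg h4 h3]

lemma x_lt {r ρ : ℝ} (hρr : ρ < r) : ENNReal.ofReal (√((2 : ℝ) ^ ρ / (2 : ℝ) ^ r)) < 1 := by
  rw [ENNReal.ofReal_lt_one, Real.sqrt_lt' one_pos, one_pow, div_lt_one (by positivity)]
  exact Real.rpow_lt_rpow_of_exponent_lt (by norm_num) hρr

lemma x_ne {r ρ : ℝ} : ENNReal.ofReal (√((2 : ℝ) ^ ρ / (2 : ℝ) ^ r)) ≠ 0 := by
  have : 0 < √((2 : ℝ) ^ ρ / (2 : ℝ) ^ r) := by positivity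
  simpa using this

lemma beta_le (S : ApproximationScheme X) {r C₁ ρ : ℝ} (hC₁ : 0 < C₁)
    (jackson : ∀ (g : Y) (n : ℕ), approxError S (j g) n ≤ C₁ * ((n : ℝ) + 1) ^ (-r) * ‖g‖)
    (f : X) (k : ℕ) :
    ENNReal.ofReal (((2 : ℝ) ^ ρ) ^ k * approxError S f (2 ^ k - 1)) ≤
    ENNReal.ofReal (1 + C₁) *
    ENNReal.ofReal (((2 : ℝ) ^ ρ) ^ k * KfunXY j f ((((2 : ℝ) ^ r)⁻¹) ^ k)) := by
  have h := jackson_K j S hC₁ jackson f (2 ^ k - 1)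
  rw [y_pow] at h
  rw [← ENNReal.ofReal_mul (by positivity)]
  apply ENNReal.ofReal_le_ofReal
  rw [mul_left_comm]
  gcongr

theorem core
    (S : ApproximationScheme X) (hj : Function.Injective j)
    (hA : ∀ n : ℕ, S.A n ⊆ Set.range j)
    (r : ℝ) (hr : 0 < r)
    (C₁ : ℝ) (hC₁ : 0 < C₁)
    (jackson : ∀ (g : Y) (n : ℕ), approxError S (j g) n ≤ C₁ * ((n : ℝ) + 1) ^ (-r) * ‖g‖)
    (C₂ : ℝ) (hC₂ : 0 < C₂)
    (bernstein : ∀ n : ℕ, 1 ≤ n → ∀ g : Y, j g ∈ S.A n → ‖g‖ ≤ C₂ * (n : ℝ) ^ r * ‖j g‖)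
    (ρ : ℝ) (hρ : 0 < ρ) (hρr : ρ < r) (μ : ℝ≥0∞) (hμ : 0 < μ) :
    ∃ c₁ c₂ : ℝ≥0∞, c₁ ≠ ∞ ∧ c₂ ≠ ∞ ∧ ∀ f : X,
      interpNormXY j (ρ / r) μ f ≤ c₁ * apNorm S ρ μ f ∧
      apNorm S ρ μ f ≤ c₂ * interpNormXY j (ρ / r) μ f := by
  have hθ : 0 < ρ / r := by positivity
  set y := ((2 : ℝ) ^ r)⁻¹ with hydef
  have hy : 0 < y := by positivity
  have hy1 : y < 1 := inv_lt_one_of_one_lt₀ (Real.one_lt_rpow (by norm_num) hr)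
  have hyθ : y ^ (-(ρ / r)) = (2 : ℝ) ^ ρ := y_theta hr
  have hE := err_nonneg S
  have hx := x_lt hρr
  have hx0 := @x_ne r ρ
  have hkap := fun f => kappa_le j S hA hρr hC₂ bernstein hj f
  have hbet := fun f => beta_le j S (ρ := ρ) hC₁ jackson f
  rw [← hydef] at hkap hbet
  set x := ENNReal.ofReal (√((2 : ℝ) ^ ρ / (2 : ℝ) ^ r))
  have hxi : (1 - x)⁻¹ ≠ ∞ := ENNReal.inv_ne_top.2 (tsub_pos_of_lt hx).ne'
  set D := ENNReal.ofReal (1 + 2 * C₂ * ((2 : ℝ) ^ r) ^ 2) with hD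
  have hDt : D ≠ ∞ := ENNReal.ofReal_ne_top
  by_cases hμt : μ = ∞
  · refine ⟨ENNReal.ofReal ((2 : ℝ) ^ ρ) * (D * (1 - x)⁻¹) + 1,
      ENNReal.ofReal ((2 : ℝ) ^ ρ) * ENNReal.ofReal (1 + C₁), ?_, ?_, fun f => ?_⟩
    · exact ENNReal.add_ne_top.2 ⟨ENNReal.mul_ne_top ENNReal.ofReal_ne_top
        (ENNReal.mul_ne_top hDt hxi), ENNReal.one_ne_top⟩
    · exact ENNReal.mul_ne_top ENNReal.ofReal_ne_top ENNReal.ofReal_ne_top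
    unfold interpNormXY apNorm
    rw [if_pos hμt, if_pos hμt]
    constructor
    · set T := ⨆ n : ℕ, ENNReal.ofReal (((n : ℝ) + 1) ^ ρ * approxError S f n) with hT
      have hβ : ∀ k : ℕ, ENNReal.ofReal (((2 : ℝ) ^ ρ) ^ k * approxError S f (2 ^ k - 1)) ≤ T := by
        intro k
        refine le_trans (le_of_eq ?_) (le_iSup _ (2 ^ k - 1))
        rw [Nat.cast_sub Nat.one_le_two_pow]
        push_cast
        rw [sub_add_cancel, two_rpow_nat]
      have hκ : ∀ k : ℕ, ENNReal.ofReal (((2 : ℝ) ^ ρ) ^ k * KfunXY j f (y ^ k)) ≤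
          D * (1 - x)⁻¹ * T := by
        intro k
        refine (hkap f k).trans ?_
        rw [mul_assoc]
        gcongr
        calc _ ≤ ∑ m ∈ Finset.range (k + 1), x ^ (k - m) * T := by
              apply Finset.sum_le_sum
              intro m _
              gcongr ?_ * ?_
              · exact pow_le_pow_right_of_le_one' hx.le (by omega)
              · exact hβ m
          _ = (∑ m ∈ Finset.range (k + 1), x ^ (k - m)) * T := by rw [Finset.sum_mul]
          _ ≤ _ := by
            gcongr
            rw [← ENNReal.tsum_geometric]
            have := Finset.sum_range_reflect (fun i => x ^ i) (k + 1)
            simp only [Nat.add_sub_cancel] at this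
            rw [this]
            exact ENNReal.sum_le_tsum _
      apply iSup₂_le
      intro t ht
      have ht0 : 0 < t := ht
      have hK0 := K_nonneg j f ht0.le
      rcases le_or_gt t 1 with h | h
      · obtain ⟨k, hk⟩ := Ioc_cover hy hy1 ht0 h
        calc _ ≤ ENNReal.ofReal ((2 : ℝ) ^ ρ) *
              ENNReal.ofReal (((2 : ℝ) ^ ρ) ^ k * KfunXY j f (y ^ k)) := by
              rw [← ENNReal.ofReal_mul (by positivity)]
              apply ENNReal.ofReal_le_ofReal
              rw [← mul_assoc, ← pow_succ', ← hyθ, ← pow_rpow_neg hy]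
              have h2 : t ^ (-(ρ / r)) ≤ (y ^ (k + 1)) ^ (-(ρ / r)) :=
                Real.rpow_le_rpow_of_nonpos (by positivity) hk.1.le (by linarith)
              have h3 := K_mono j f ht0.le hk.2
              gcongr
          _ ≤ ENNReal.ofReal ((2 : ℝ) ^ ρ) * (D * (1 - x)⁻¹ * T) := by
              gcongr
              exact hκ k
          _ ≤ _ := by
              rw [add_mul, ← mul_assoc]
              exact le_self_add
      · have h1 := hβ 0
        simp only [pow_zero, one_mul, tsub_self, err_zero] at h1
        calc _ ≤ ENNReal.ofReal ‖f‖ := by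
              apply ENNReal.ofReal_le_ofReal
              have h2 := K_le_norm j f ht0.le
              have h3 : t ^ (-(ρ / r)) ≤ 1 :=
                Real.rpow_le_one_of_one_le_of_nonpos h.le (by linarith)
              calc _ ≤ 1 * ‖f‖ := by gcongr
                _ = _ := one_mul _
          _ ≤ T := h1
          _ ≤ _ := by
              rw [add_mul, one_mul]
              exact le_add_self
    · apply iSup_le
      intro n
      set k := Nat.log 2 (n + 1) with hk
      have hk1 : 2 ^ k ≤ n + 1 := Nat.pow_log_le_self 2 (by omega)
      have hk2 : n + 1 < 2 ^ (k + 1) := Nat.lt_pow_succ_log_self (by norm_num) _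
      have hn : (n : ℝ) + 1 ≤ 2 ^ (k + 1) := by exact_mod_cast hk2.le
      calc _ ≤ ENNReal.ofReal ((2 : ℝ) ^ ρ) *
            ENNReal.ofReal (((2 : ℝ) ^ ρ) ^ k * approxError S f (2 ^ k - 1)) := by
            rw [← ENNReal.ofReal_mul (by positivity)]
            apply ENNReal.ofReal_le_ofReal
            rw [← mul_assoc, ← pow_succ', ← two_rpow_nat]
            have := hE f n
            gcongr
            exact err_anti S f (by omega)
        _ ≤ ENNReal.ofReal ((2 : ℝ) ^ ρ) * (ENNReal.ofReal (1 + C₁) *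
            ENNReal.ofReal (((2 : ℝ) ^ ρ) ^ k * KfunXY j f (y ^ k))) := by
            gcongr
            exact hbet f k
        _ ≤ _ := by
            rw [← mul_assoc]
            gcongr
            rw [← hyθ, ← pow_rpow_neg hy]
            exact le_iSup₂_of_le (y ^ k) (Set.mem_Ioi.2 (by positivity)) le_rfl
  · have hp : 0 < μ.toReal := ENNReal.toReal_pos hμ.ne' hμt
    have hinv : (μ⁻¹).toReal = (μ.toReal)⁻¹ := ENNReal.toReal_inv μ
    set p := μ.toReal
    have hxp : x ^ p < 1 := ENNReal.rpow_lt_one hx hp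
    have hxpi : (1 - x ^ p)⁻¹ ≠ ∞ := ENNReal.inv_ne_top.2 (tsub_pos_of_lt hxp).ne'
    set H := (D * (1 - x)⁻¹) ^ p * (1 - x ^ p)⁻¹ with hH
    have hHt : H ≠ ∞ := ENNReal.mul_ne_top
      (ENNReal.rpow_ne_top_of_nonneg hp.le (ENNReal.mul_ne_top hDt hxi)) hxpi
    set J := ∫⁻ t in Set.Ioi (1 : ℝ), ENNReal.ofReal (t ^ (-(ρ / r) * p - 1)) with hJ
    have hJt : J ≠ ∞ := (J_lt_top hθ hp).ne
    set U := ENNReal.ofReal (((2 : ℝ) ^ ρ) ^ p * y⁻¹) with hU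
    set B := 1 + ENNReal.ofReal (((2 : ℝ) ^ ρ) ^ p * 2) with hB
    have hBt : B ≠ ∞ := ENNReal.add_ne_top.2 ⟨ENNReal.one_ne_top, ENNReal.ofReal_ne_top⟩
    set M := ENNReal.ofReal (1 + C₁) with hM
    set V := ENNReal.ofReal (((2 : ℝ) ^ ρ) ^ p) with hV
    set W := ENNReal.ofReal (y ^ p * (1 - y)) with hW
    have hW0 : W ≠ 0 := by
      have : 0 < y ^ p * (1 - y) := mul_pos (by positivity) (by linarith)
      simpa [hW] using this
    refine ⟨((U * H + J) * B) ^ (1 / p), (V * M ^ p * W⁻¹) ^ (1 / p), ?_, ?_, fun f => ?_⟩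
    · exact ENNReal.rpow_ne_top_of_nonneg (by positivity) (ENNReal.mul_ne_top
        (ENNReal.add_ne_top.2 ⟨ENNReal.mul_ne_top ENNReal.ofReal_ne_top hHt, hJt⟩) hBt)
    · exact ENNReal.rpow_ne_top_of_nonneg (by positivity) (ENNReal.mul_ne_top
        (ENNReal.mul_ne_top ENNReal.ofReal_ne_top
          (ENNReal.rpow_ne_top_of_nonneg hp.le ENNReal.ofReal_ne_top)) (ENNReal.inv_ne_top.2 hW0))
    unfold interpNormXY apNorm
    rw [if_neg hμt, if_neg hμt, hinv]
    have hap1 := ap_le_dyadic (approxError S f) (hE f) (err_anti S f) hρ hp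
    have hap2 := dyadic_le_ap (approxError S f) (hE f) (err_anti S f) hρ hp
    have hin1 := int_upper (KfunXY j f) (fun t ht => K_nonneg j f ht)
      (fun s t hs h => K_mono j f hs h) ‖f‖ (fun t ht => K_le_norm j f ht) hy hy1 hθ hp
    have hin2 := int_lower (KfunXY j f) (fun t ht => K_nonneg j f ht)
      (fun s t hs h => K_quasi j f hs h) hy hy1 hθ hp
    have hhar := hardy _ _ x hx0 hx hp D (hkap f)
    rw [hyθ] at hin1 hin2
    have hf : ENNReal.ofReal ‖f‖ ^ p ≤
        ∑' k : ℕ, ENNReal.ofReal (((2 : ℝ) ^ ρ) ^ k * approxError S f (2 ^ k - 1)) ^ p := by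
      refine le_trans (le_of_eq ?_) (ENNReal.le_tsum 0)
      simp only [pow_zero, one_mul, tsub_self, err_zero]
    have hbk : ∑' k : ℕ, ENNReal.ofReal (((2 : ℝ) ^ ρ) ^ k * approxError S f (2 ^ k - 1)) ^ p ≤
        M ^ p * ∑' k : ℕ, ENNReal.ofReal (((2 : ℝ) ^ ρ) ^ k * KfunXY j f (y ^ k)) ^ p := by
      rw [← ENNReal.tsum_mul_left]
      apply ENNReal.tsum_le_tsum
      intro k
      rw [← ENNReal.mul_rpow_of_nonneg _ _ hp.le]
      exact ENNReal.rpow_le_rpow (hbet f k) hp.le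
    set A := ∑' n : ℕ, ENNReal.ofReal ((((n : ℝ) + 1) ^ (ρ - p⁻¹) * approxError S f n) ^ p)
    set I := ∫⁻ t in Set.Ioi (0 : ℝ), ENNReal.ofReal ((t ^ (-(ρ / r)) * KfunXY j f t) ^ p / t)
    set β := ∑' k : ℕ, ENNReal.ofReal (((2 : ℝ) ^ ρ) ^ k * approxError S f (2 ^ k - 1)) ^ p
    set κ := ∑' k : ℕ, ENNReal.ofReal (((2 : ℝ) ^ ρ) ^ k * KfunXY j f (y ^ k)) ^ p
    constructor
    · apply rpow_conv hp
      calc I ≤ U * κ + J * ENNReal.ofReal ‖f‖ ^ p := hin1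
        _ ≤ U * (H * β) + J * β := by gcongr
        _ = (U * H + J) * β := by ring
        _ ≤ (U * H + J) * (B * A) := by gcongr
        _ = _ := by ring
    · apply rpow_conv hp
      have hWt : W ≠ ∞ := ENNReal.ofReal_ne_top
      calc A ≤ V * β := hap1
        _ ≤ V * (M ^ p * κ) := by gcongr
        _ = V * M ^ p * W⁻¹ * (W * κ) := by
          rw [← mul_assoc, mul_assoc (V * M ^ p), ← mul_assoc W⁻¹, ENNReal.inv_mul_cancel hW0 hWt,
            one_mul]
        _ ≤ _ := by gcongr

end Final

end ApproxAux

/-- If the pair `(X, Y)` (with `Y` a Banach space continuously and injectively embedded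
in `X`, containing all the sets `A n`) satisfies the Jackson inequality
`α_n(f, X) ≤ C₁ n^{-r} ‖f‖_Y` and the Bernstein inequality `‖g‖_Y ≤ C₂ n^r ‖g‖_X`
(`g ∈ A n`, `n ≥ 1`), then for all `0 < ρ < r` and `0 < μ ≤ ∞` the approximation space
`X^ρ_μ` coincides with the real interpolation space `(X, Y)_{ρ/r, μ}`, with equivalent
(quasi-)norms.  (Here `approxError S f n = α_{n+1}(f, X)`.) -/
theorem approx_space_eq_interpolation_space [CompleteSpace X]
    {Y : Type*} [NormedAddCommGroup Y] [NormedSpace ℂ Y] [CompleteSpace Y]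
    (S : ApproximationScheme X) (j : Y →L[ℂ] X) (hj : Function.Injective j)
    (hA : ∀ n : ℕ, S.A n ⊆ Set.range j)
    (r : ℝ) (hr : 0 < r)
    (C₁ : ℝ) (hC₁ : 0 < C₁)
    (jackson : ∀ (g : Y) (n : ℕ), approxError S (j g) n ≤ C₁ * ((n : ℝ) + 1) ^ (-r) * ‖g‖)
    (C₂ : ℝ) (hC₂ : 0 < C₂)
    (bernstein : ∀ n : ℕ, 1 ≤ n → ∀ g : Y, j g ∈ S.A n → ‖g‖ ≤ C₂ * (n : ℝ) ^ r * ‖j g‖)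
    (ρ : ℝ) (hρ : 0 < ρ) (hρr : ρ < r) (μ : ℝ≥0∞) (hμ : 0 < μ) :
    ∃ c₁ c₂ : ℝ, 0 < c₁ ∧ 0 < c₂ ∧ ∀ f : X,
      ENNReal.ofReal c₁ * interpNormXY j (ρ / r) μ f ≤ apNorm S ρ μ f ∧
      apNorm S ρ μ f ≤ ENNReal.ofReal c₂ * interpNormXY j (ρ / r) μ f := by
  obtain ⟨d₁, d₂, h₁, h₂, h⟩ := ApproxAux.core j S hj hA r hr C₁ hC₁ jackson C₂ hC₂ bernstein
    ρ hρ hρr μ hμ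
  have e1 : (0 : ℝ) < d₁.toReal + 1 := by positivity
  refine ⟨(d₁.toReal + 1)⁻¹, d₂.toReal + 1, by positivity, by positivity, fun f => ⟨?_, ?_⟩⟩
  · rw [ENNReal.ofReal_inv_of_pos e1, ENNReal.inv_mul_le_iff
      (by simpa using e1) ENNReal.ofReal_ne_top]
    refine (h f).1.trans ?_
    gcongr
    rw [ENNReal.le_ofReal_iff_toReal_le h₁ e1.le]
    linarith
  · refine (h f).2.trans ?_
    gcongr
    rw [ENNReal.le_ofReal_iff_toReal_le h₂ (by positivity)]
    linarith
end
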